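/- arXiv:1309.3518 — 2 statements merged into one kernel-verified Lean document; each statement's English description precedes it below -/
import Mathlib

section
/- Let n ≥ 1 and α ∈ [0,1). For a measurable function f on (0,1)×ℝⁿ with f(t,·) ∈ L¹(ℝⁿ) for a.e. t, set 𝖩(f;α) = sup over (r,x) ∈ (0,1)×ℝⁿ of r^{2α−n} ∫_0^{r²} ∫_{B(x,r)} |f(t,y)| t^{−α} dy dt, and let f̂(s,ζ) = ∫_{ℝⁿ} f(s,y) e^{−2πi y·ζ} dy be the Fourier transform in the space variable. Then there is a constant C = C(n,α) > 0 such that ∫_0^1 ( ∫_{ℝⁿ} (2π|ζ|)² e^{−8π²t|ζ|²} | ∫_0^t f̂(s,ζ) ds |² dζ ) t^{−α} dt ≤ C · 𝖩(f;α) · ∫_0^1 ‖f(t,·)‖_{L¹(ℝⁿ)} t^{−α} dt. -/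
open MeasureTheory Metric Real
open scoped ENNReal NNReal RealInnerProductSpace

noncomputable section

/-- The spatial Fourier transform `f̂(s,ζ) = ∫_{ℝⁿ} f(s,y) e^{−2πi y·ζ} dy`. -/
def spaceFourier (n : ℕ) (f : ℝ → EuclideanSpace ℝ (Fin n) → ℂ) (s : ℝ)
    (ζ : EuclideanSpace ℝ (Fin n)) : ℂ :=
  ∫ y, f s y * Complex.exp (-(2 * π * ⟪y, ζ⟫ : ℝ) * Complex.I)

/-- The quantity `𝖩(f;α)`, a sup over `(r,x) ∈ (0,1)×ℝⁿ`. -/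
def Jquant (n : ℕ) (α : ℝ) (f : ℝ → EuclideanSpace ℝ (Fin n) → ℂ) : ℝ≥0∞ :=
  ⨆ (r : ℝ) (_ : r ∈ Set.Ioo (0 : ℝ) 1) (x : EuclideanSpace ℝ (Fin n)),
    ENNReal.ofReal (r ^ (2 * α - (n : ℝ))) *
      ∫⁻ t in Set.Ioo (0 : ℝ) (r ^ 2),
        (∫⁻ y in Metric.ball x r, (‖f t y‖₊ : ℝ≥0∞)) * ENNReal.ofReal (t ^ (-α))

open Set in
/-- Integration by parts for `w · (∫₀ᵗ φ)²`, where `w` is absolutely continuous and `φ` is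
integrable. -/
lemma integral_deriv_mul_primitive_sq {φ w : ℝ → ℝ} {ε b : ℝ} (hε : 0 ≤ ε) (hb : ε ≤ b)
    (hφ : IntervalIntegrable φ volume 0 b) (hw : AbsolutelyContinuousOnInterval w ε b) :
    ∫ t in ε..b, -deriv w t * (∫ s in (0 : ℝ)..t, φ s) ^ 2 =
      w ε * (∫ s in (0 : ℝ)..ε, φ s) ^ 2 - w b * (∫ s in (0 : ℝ)..b, φ s) ^ 2 +
        2 * ∫ t in ε..b, w t * (φ t * ∫ s in (0 : ℝ)..t, φ s) := by
  set a : ℝ → ℝ := fun t => ∫ s in (0 : ℝ)..t, φ s with ha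
  have hsub : uIcc ε b ⊆ uIcc 0 b := by
    rw [uIcc_of_le hb, uIcc_of_le (hε.trans hb)]
    exact Icc_subset_Icc_left hε
  have hac : AbsolutelyContinuousOnInterval a ε b :=
    (hφ.absolutelyContinuousOnInterval_intervalIntegral (by simp)).mono hsub
  have hsq := hac.fun_mul hac
  have key := hw.integral_mul_deriv_eq_deriv_mul hsq
  have hd : ∫ t in ε..b, w t * deriv (fun x => a x * a x) t
      = 2 * ∫ t in ε..b, w t * (φ t * a t) := by
    rw [← intervalIntegral.integral_const_mul]
    apply intervalIntegral.integral_congr_ae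
    filter_upwards [hφ.ae_hasDerivAt_integral] with t ht hmem
    have h := ht (hsub (uIoc_subset_uIcc hmem)) 0 (by simp)
    have h2 : HasDerivAt (fun x => a x * a x) (φ t * a t + a t * φ t) t := h.mul h
    rw [h2.deriv]
    ring
  rw [hd] at key
  have hn : ∫ t in ε..b, -deriv w t * a t ^ 2 = -∫ t in ε..b, deriv w t * (a t * a t) := by
    rw [← intervalIntegral.integral_neg]
    congr 1
    ext t
    ring
  rw [hn]
  linarith

/-- The weight `t ^ (-α) * exp (-c t)` together with its derivative. -/
lemma hasDerivAt_rpow_neg_mul_exp {α c t : ℝ} (ht : 0 < t) :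
    HasDerivAt (fun t : ℝ => t ^ (-α) * Real.exp (-c * t))
      (-(α * t ^ (-α - 1) + c * t ^ (-α)) * Real.exp (-c * t)) t := by
  have h1 := Real.hasDerivAt_rpow_const (x := t) (p := -α) (Or.inl ht.ne')
  have h2 : HasDerivAt (fun t : ℝ => Real.exp (-c * t)) (Real.exp (-c * t) * (-c * 1)) t :=
    ((hasDerivAt_id t).const_mul (-c)).exp
  refine (h1.mul h2).congr_deriv ?_
  ring

lemma absolutelyContinuousOnInterval_rpow_neg_mul_exp {α c ε b : ℝ} (hε : 0 < ε) (hb : ε ≤ b) :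
    AbsolutelyContinuousOnInterval (fun t : ℝ => t ^ (-α) * Real.exp (-c * t)) ε b := by
  apply ContDiffOn.absolutelyContinuousOnInterval
  rw [Set.uIcc_of_le hb]
  intro t ht
  have ht0 : t ≠ 0 := (hε.trans_le ht.1).ne'
  apply ContDiffAt.contDiffWithinAt
  exact (Real.contDiffAt_rpow_const_of_ne ht0).mul (by fun_prop)

open Set in
/-- Weighted energy inequality for the primitive of a complex valued integrable function. -/
lemma weighted_energy_le {φ : ℝ → ℂ} {α c ε : ℝ} (hα : 0 ≤ α) (hε : 0 < ε) (hε1 : ε < 1)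
    (hφ : IntegrableOn φ (Ioo 0 1)) :
    ∫ t in Ioo ε 1, c * Real.exp (-c * t) * t ^ (-α) * ‖∫ s in Ioo 0 t, φ s‖ ^ 2 ≤
      ε ^ (-α) * Real.exp (-c * ε) * ‖∫ s in Ioo 0 ε, φ s‖ ^ 2 +
        2 * ∫ t in Ioo ε 1, t ^ (-α) * Real.exp (-c * t) *
          (φ t * (starRingEnd ℂ) (∫ s in Ioo 0 t, φ s)).re := by
  set w : ℝ → ℝ := fun t : ℝ => t ^ (-α) * Real.exp (-c * t) with hwdef
  have hw : AbsolutelyContinuousOnInterval w ε 1 :=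
    absolutelyContinuousOnInterval_rpow_neg_mul_exp hε hε1.le
  have hre : IntervalIntegrable (fun t => (φ t).re) volume 0 1 := by
    rw [intervalIntegrable_iff_integrableOn_Ioo_of_le zero_le_one]
    exact hφ.re
  have him : IntervalIntegrable (fun t => (φ t).im) volume 0 1 := by
    rw [intervalIntegrable_iff_integrableOn_Ioo_of_le zero_le_one]
    exact hφ.im
  set u : ℝ → ℝ := fun t => ∫ s in (0 : ℝ)..t, (φ s).re with hu
  set v : ℝ → ℝ := fun t => ∫ s in (0 : ℝ)..t, (φ s).im with hv
  have hprim : ∀ t, 0 ≤ t → t ≤ 1 → (∫ s in Ioo 0 t, φ s) = ⟨u t, v t⟩ := by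
    intro t ht ht1
    have hi : IntegrableOn φ (Ioo 0 t) := hφ.mono_set (Ioo_subset_Ioo_right ht1)
    apply Complex.ext
    · simp only [hu, intervalIntegral.integral_of_le ht, integral_Ioc_eq_integral_Ioo]
      exact (integral_re hi).symm
    · simp only [hv, intervalIntegral.integral_of_le ht, integral_Ioc_eq_integral_Ioo]
      exact (integral_im hi).symm
  have hnorm : ∀ t, 0 ≤ t → t ≤ 1 → ‖∫ s in Ioo 0 t, φ s‖ ^ 2 = u t ^ 2 + v t ^ 2 := by
    intro t ht ht1
    rw [hprim t ht ht1, ← Complex.normSq_eq_norm_sq, Complex.normSq_apply]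
    ring
  have hsub : uIcc ε 1 ⊆ uIcc (0 : ℝ) 1 := by
    rw [uIcc_of_le hε1.le, uIcc_of_le zero_le_one]
    exact Icc_subset_Icc_left hε.le
  have hu_ac : AbsolutelyContinuousOnInterval u ε 1 :=
    (hre.absolutelyContinuousOnInterval_intervalIntegral (by simp)).mono hsub
  have hv_ac : AbsolutelyContinuousOnInterval v ε 1 :=
    (him.absolutelyContinuousOnInterval_intervalIntegral (by simp)).mono hsub
  have eu := integral_deriv_mul_primitive_sq hε.le hε1.le hre hw
  have ev := integral_deriv_mul_primitive_sq hε.le hε1.le him hw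
  have hdw : IntervalIntegrable (fun t => -deriv w t) volume ε 1 := hw.intervalIntegrable_deriv.neg
  have iu : IntervalIntegrable (fun t => -deriv w t * u t ^ 2) volume ε 1 :=
    hdw.mul_continuousOn (hu_ac.continuousOn.pow 2)
  have iv : IntervalIntegrable (fun t => -deriv w t * v t ^ 2) volume ε 1 :=
    hdw.mul_continuousOn (hv_ac.continuousOn.pow 2)
  have ju : IntervalIntegrable (fun t => w t * ((φ t).re * u t)) volume ε 1 :=
    ((hre.mono_set hsub).mul_continuousOn hu_ac.continuousOn).continuousOn_mul hw.continuousOn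
  have jv : IntervalIntegrable (fun t => w t * ((φ t).im * v t)) volume ε 1 :=
    ((him.mono_set hsub).mul_continuousOn hv_ac.continuousOn).continuousOn_mul hw.continuousOn
  have hB : ∫ t in Ioo ε 1, t ^ (-α) * Real.exp (-c * t) *
      (φ t * (starRingEnd ℂ) (∫ s in Ioo 0 t, φ s)).re =
      (∫ t in ε..1, w t * ((φ t).re * u t)) + ∫ t in ε..1, w t * ((φ t).im * v t) := by
    rw [← intervalIntegral.integral_add ju jv, intervalIntegral.integral_of_le hε1.le,
      integral_Ioc_eq_integral_Ioo]
    refine setIntegral_congr_fun measurableSet_Ioo fun t ht => ?_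
    simp only [hprim t (hε.trans ht.1).le ht.2.le, Complex.mul_re, Complex.conj_re,
      Complex.conj_im, hwdef]
    ring
  have hA : ∫ t in Ioo ε 1, c * Real.exp (-c * t) * t ^ (-α) * ‖∫ s in Ioo 0 t, φ s‖ ^ 2 ≤
      (∫ t in ε..1, -deriv w t * u t ^ 2) + ∫ t in ε..1, -deriv w t * v t ^ 2 := by
    rw [← intervalIntegral.integral_add iu iv, intervalIntegral.integral_of_le hε1.le,
      integral_Ioc_eq_integral_Ioo]
    have hcont : ContinuousOn (fun t => c * Real.exp (-c * t) * t ^ (-α) * (u t ^ 2 + v t ^ 2))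
        (uIcc ε 1) := by
      have hpow : ContinuousOn (fun t : ℝ => t ^ (-α)) (uIcc ε 1) := by
        intro t ht
        rw [uIcc_of_le hε1.le] at ht
        exact (Real.continuousAt_rpow_const _ _ (Or.inl (hε.trans_le ht.1).ne')).continuousWithinAt
      exact ((by fun_prop : Continuous fun t => c * Real.exp (-c * t)).continuousOn.mul hpow).mul
        ((hu_ac.continuousOn.pow 2).add (hv_ac.continuousOn.pow 2))
    have hint := hcont.intervalIntegrable (μ := volume)
    rw [intervalIntegrable_iff_integrableOn_Ioo_of_le hε1.le] at hint
    have hint' := iu.add iv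
    rw [intervalIntegrable_iff_integrableOn_Ioo_of_le hε1.le] at hint'
    rw [setIntegral_congr_fun measurableSet_Ioo (g := fun t => c * Real.exp (-c * t) * t ^ (-α) *
      (u t ^ 2 + v t ^ 2)) fun t ht => by simp only [hnorm t (hε.trans ht.1).le ht.2.le]]
    refine setIntegral_mono_on hint hint' measurableSet_Ioo fun t ht => ?_
    have ht0 : 0 < t := hε.trans ht.1
    have hd : deriv w t = _ := (hasDerivAt_rpow_neg_mul_exp ht0).deriv
    simp only [hd]
    have : 0 ≤ α * t ^ (-α - 1) * Real.exp (-c * t) * (u t ^ 2 + v t ^ 2) := by positivity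
    nlinarith
  have hw1 : 0 ≤ w 1 := by positivity
  rw [hnorm ε hε.le hε1.le, hB]
  have h1 := mul_nonneg hw1 (sq_nonneg (u 1))
  have h2 := mul_nonneg hw1 (sq_nonneg (v 1))
  have h3 : w ε = ε ^ (-α) * Real.exp (-c * ε) := rfl
  simp only [← h3]
  linarith

/-- The kernel of `e^{2tΔ}` on `ℝⁿ`. -/
def gaussKernel {n : ℕ} (t : ℝ) (w : EuclideanSpace ℝ (Fin n)) : ℝ :=
  (1 / (8 * π * t)) ^ ((n : ℝ) / 2) * Real.exp (-‖w‖ ^ 2 / (8 * t))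

/-- The character `e^{−2πi y·ζ}`. -/
def planeWave {n : ℕ} (y ζ : EuclideanSpace ℝ (Fin n)) : ℂ :=
  Complex.exp (-(2 * π * ⟪y, ζ⟫ : ℝ) * Complex.I)

lemma norm_planeWave {n : ℕ} (y ζ : EuclideanSpace ℝ (Fin n)) : ‖planeWave y ζ‖ = 1 := by
  rw [planeWave, ← Complex.ofReal_neg, Complex.norm_exp_ofReal_mul_I]

lemma continuous_planeWave {n : ℕ} :
    Continuous fun p : EuclideanSpace ℝ (Fin n) × EuclideanSpace ℝ (Fin n) =>
      planeWave p.1 p.2 := by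
  unfold planeWave
  fun_prop

lemma planeWave_mul_conj {n : ℕ} (x y ζ : EuclideanSpace ℝ (Fin n)) :
    planeWave x ζ * (starRingEnd ℂ) (planeWave y ζ) = planeWave (x - y) ζ := by
  simp only [planeWave, ← Complex.exp_conj, ← Complex.exp_add, inner_sub_left]
  congr 1
  simp only [Complex.ofReal_mul, Complex.ofReal_ofNat, neg_mul, map_neg, map_mul, Complex.conj_I,
    Complex.conj_ofReal, Complex.ofReal_sub, map_ofNat]
  ring

lemma gaussKernel_pos {n : ℕ} {t : ℝ} (ht : 0 < t) (w : EuclideanSpace ℝ (Fin n)) :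
    0 < gaussKernel t w := by
  unfold gaussKernel
  positivity

lemma continuous_gaussKernel {n : ℕ} (t : ℝ) :
    Continuous fun w : EuclideanSpace ℝ (Fin n) => gaussKernel t w := by
  unfold gaussKernel
  fun_prop

lemma integrable_exp_neg_mul_sq_norm {n : ℕ} {b : ℝ} (hb : 0 < b) :
    Integrable fun ζ : EuclideanSpace ℝ (Fin n) => Real.exp (-b * ‖ζ‖ ^ 2) := by
  have h := (GaussianFourier.integrable_cexp_neg_mul_sq_norm_add
    (V := EuclideanSpace ℝ (Fin n)) (b := b) (by simpa using hb) 0 0).norm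
  refine h.congr (Filter.Eventually.of_forall fun ζ => ?_)
  simp only [Complex.norm_exp]
  congr 1
  simp [← Complex.ofReal_pow]

lemma integral_exp_mul_planeWave {n : ℕ} {t : ℝ} (ht : 0 < t) (w : EuclideanSpace ℝ (Fin n)) :
    ∫ ζ, (Real.exp (-(8 * π ^ 2 * t) * ‖ζ‖ ^ 2) : ℂ) * planeWave w ζ = gaussKernel t w := by
  have hb : 0 < ((8 * π ^ 2 * t : ℝ) : ℂ).re := by
    rw [Complex.ofReal_re]; positivity
  have h := GaussianFourier.integral_cexp_neg_mul_sq_norm_add hb (-(2 * π * Complex.I)) w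
  have e1 : ∀ ζ : EuclideanSpace ℝ (Fin n),
      (Real.exp (-(8 * π ^ 2 * t) * ‖ζ‖ ^ 2) : ℂ) * planeWave w ζ =
        Complex.exp (-((8 * π ^ 2 * t : ℝ) : ℂ) * ‖ζ‖ ^ 2 + (-(2 * π * Complex.I)) * ⟪w, ζ⟫) := by
    intro ζ
    rw [planeWave, Complex.ofReal_exp, ← Complex.exp_add]
    congr 1
    push_cast
    ring
  simp_rw [e1]
  rw [h, gaussKernel]
  have hπ : (π : ℂ) ≠ 0 := by exact_mod_cast Real.pi_ne_zero
  have htc : (t : ℂ) ≠ 0 := by exact_mod_cast ht.ne'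
  have e2 : ((π : ℂ) / ((8 * π ^ 2 * t : ℝ) : ℂ)) = ((1 / (8 * π * t) : ℝ) : ℂ) := by
    push_cast
    field_simp
  have e3 : ((Module.finrank ℝ (EuclideanSpace ℝ (Fin n)) : ℂ) / 2) = (((n : ℝ) / 2 : ℝ) : ℂ) := by
    simp
  rw [e2, e3, ← Complex.ofReal_cpow (by positivity)]
  push_cast
  congr 2
  field_simp
  rw [Complex.I_sq]
  ring

lemma lintegral_gaussKernel {n : ℕ} {t : ℝ} (ht : 0 < t) (y : EuclideanSpace ℝ (Fin n)) :
    ∫⁻ x, ENNReal.ofReal (gaussKernel t (y - x)) = 1 := by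
  rw [lintegral_sub_left_eq_self (fun x => ENNReal.ofReal (gaussKernel t x)) y]
  have hb : 0 < 1 / (8 * t) := by positivity
  have e : ∀ x : EuclideanSpace ℝ (Fin n), gaussKernel t x =
      (1 / (8 * π * t)) ^ ((n : ℝ) / 2) * Real.exp (-(1 / (8 * t)) * ‖x‖ ^ 2) := by
    intro x
    rw [gaussKernel]
    congr 2
    ring
  rw [← ofReal_integral_eq_lintegral_ofReal]
  · simp_rw [e]
    rw [integral_const_mul, GaussianFourier.integral_rexp_neg_mul_sq_norm hb,
      finrank_euclideanSpace_fin, ← Real.mul_rpow (by positivity) (by positivity)]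
    have : 1 / (8 * π * t) * (π / (1 / (8 * t))) = 1 := by
      field_simp
    rw [this]
    simp
  · exact ((integrable_exp_neg_mul_sq_norm hb).const_mul _).congr
      (Filter.Eventually.of_forall fun x => (e x).symm)
  · exact Filter.Eventually.of_forall fun x => (gaussKernel_pos ht x).le

lemma enorm_integral_exp_mul_fourier_le {n : ℕ} {X : Type*} [MeasurableSpace X] {μ : Measure X}
    [SFinite μ] {g : X → ℂ} (hg : Integrable g μ) {w : X → EuclideanSpace ℝ (Fin n)}
    (hw : Measurable w) {t : ℝ} (ht : 0 < t) :
    ‖∫ ζ, (Real.exp (-(8 * π ^ 2 * t) * ‖ζ‖ ^ 2) : ℂ) * ∫ x, g x * planeWave (w x) ζ ∂μ‖ₑ ≤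
      ∫⁻ x, ‖g x‖ₑ * ENNReal.ofReal (gaussKernel t (w x)) ∂μ := by
  have hint : Integrable (Function.uncurry fun (ζ : EuclideanSpace ℝ (Fin n)) (x : X) =>
      (Real.exp (-(8 * π ^ 2 * t) * ‖ζ‖ ^ 2) : ℂ) * (g x * planeWave (w x) ζ))
      (volume.prod μ) := by
    have h0 := (integrable_exp_neg_mul_sq_norm (n := n)
      (b := 8 * π ^ 2 * t) (by positivity)).ofReal (𝕜 := ℂ)
    have h1 := h0.mul_prod hg
    have hm : AEStronglyMeasurable (fun p : EuclideanSpace ℝ (Fin n) × X =>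
        planeWave (w p.2) p.1) (volume.prod μ) :=
      (continuous_planeWave.measurable.comp
        ((hw.comp measurable_snd).prodMk measurable_fst)).aestronglyMeasurable
    refine (h1.mul_bdd (c := 1) hm ?_).congr ?_
    · exact Filter.Eventually.of_forall fun p => (norm_planeWave _ _).le
    · refine Filter.Eventually.of_forall fun p => ?_
      simp [Function.uncurry, mul_assoc]
  have hswap := integral_integral_swap hint
  have e1 : ∀ ζ : EuclideanSpace ℝ (Fin n),
      ∫ x, (Real.exp (-(8 * π ^ 2 * t) * ‖ζ‖ ^ 2) : ℂ) * (g x * planeWave (w x) ζ) ∂μ =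
      (Real.exp (-(8 * π ^ 2 * t) * ‖ζ‖ ^ 2) : ℂ) * ∫ x, g x * planeWave (w x) ζ ∂μ :=
    fun ζ => integral_const_mul _ _
  have e2 : ∀ x : X,
      ∫ ζ, (Real.exp (-(8 * π ^ 2 * t) * ‖ζ‖ ^ 2) : ℂ) * (g x * planeWave (w x) ζ) =
      g x * gaussKernel t (w x) := by
    intro x
    rw [← integral_exp_mul_planeWave ht, ← integral_const_mul]
    congr 1
    ext ζ
    ring
  simp_rw [e1, e2] at hswap
  rw [hswap]
  refine (enorm_integral_le_lintegral_enorm _).trans_eq ?_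
  refine lintegral_congr fun x => ?_
  rw [enorm_mul]
  congr 1
  rw [← ofReal_norm, Complex.norm_real, Real.norm_of_nonneg (gaussKernel_pos ht _).le]

/-- Gaussian weighted `L²` pairings of Fourier transforms are controlled by heat kernel pairings of
absolute values. -/
lemma enorm_integral_exp_mul_fourier_mul_conj_le {n : ℕ} {X Y : Type*} [MeasurableSpace X]
    [MeasurableSpace Y] {μ : Measure X} {ν : Measure Y} [SFinite μ] [SFinite ν] {g : X → ℂ}
    {h : Y → ℂ} (hg : Integrable g μ) (hh : Integrable h ν)
    {u : X → EuclideanSpace ℝ (Fin n)} {v : Y → EuclideanSpace ℝ (Fin n)}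
    (hu : Measurable u) (hv : Measurable v) {t : ℝ} (ht : 0 < t) :
    ‖∫ ζ, (Real.exp (-(8 * π ^ 2 * t) * ‖ζ‖ ^ 2) : ℂ) *
        ((∫ x, g x * planeWave (u x) ζ ∂μ) *
          (starRingEnd ℂ) (∫ y, h y * planeWave (v y) ζ ∂ν))‖ₑ ≤
      ∫⁻ x, ‖g x‖ₑ * ∫⁻ y, ‖h y‖ₑ * ENNReal.ofReal (gaussKernel t (u x - v y)) ∂ν ∂μ := by
  have hh' : Integrable (fun y => (starRingEnd ℂ) (h y)) ν :=
    (integrable_norm_iff (Complex.continuous_conj.comp_aestronglyMeasurable hh.1)).1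
      (by simpa using hh.norm)
  have hgh : Integrable (fun p : X × Y => g p.1 * (starRingEnd ℂ) (h p.2)) (μ.prod ν) :=
    hg.mul_prod hh'
  have hw : Measurable fun p : X × Y => u p.1 - v p.2 :=
    (hu.comp measurable_fst).sub (hv.comp measurable_snd)
  have key := enorm_integral_exp_mul_fourier_le hgh hw ht
  have e : ∀ ζ, ∫ p : X × Y, g p.1 * (starRingEnd ℂ) (h p.2) * planeWave (u p.1 - v p.2) ζ
      ∂(μ.prod ν) = (∫ x, g x * planeWave (u x) ζ ∂μ) *
          (starRingEnd ℂ) (∫ y, h y * planeWave (v y) ζ ∂ν) := by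
    intro ζ
    rw [← integral_conj, ← integral_prod_mul]
    congr 1
    ext p
    rw [← planeWave_mul_conj, map_mul]
    ring
  simp_rw [e] at key
  refine key.trans_eq ?_
  have hm : AEMeasurable (fun p : X × Y => ‖g p.1 * (starRingEnd ℂ) (h p.2)‖ₑ *
      ENNReal.ofReal (gaussKernel t (u p.1 - v p.2))) (μ.prod ν) :=
    hgh.1.enorm.mul ((continuous_gaussKernel t).measurable.comp hw).ennreal_ofReal.aemeasurable
  rw [lintegral_prod _ hm]
  refine lintegral_congr fun x => ?_
  rw [← lintegral_const_mul' _ _ enorm_ne_top]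
  refine lintegral_congr fun y => ?_
  rw [enorm_mul, ← mul_assoc]
  congr 2
  rw [← ofReal_norm, RCLike.norm_conj, ofReal_norm]

/-- A Gaussian at scale `√t` integrated against a measure is controlled by the largest mass the
measure gives to a ball of radius `√t`. -/
lemma lintegral_gaussKernel_mul_volume_le {n : ℕ} (ρ : Measure (EuclideanSpace ℝ (Fin n)))
    [SFinite ρ] {t : ℝ} (ht : 0 < t) {M : ℝ≥0∞} (hM : ∀ x, ρ (ball x (√t)) ≤ M)
    (y : EuclideanSpace ℝ (Fin n)) :
    (∫⁻ z, ENNReal.ofReal (gaussKernel t (y - z)) ∂ρ) *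
        volume (ball (0 : EuclideanSpace ℝ (Fin n)) (√t)) ≤
      ENNReal.ofReal (2 ^ ((n : ℝ) / 2) * Real.exp (1 / 8)) * M := by
  set K : ℝ := 2 ^ ((n : ℝ) / 2) * Real.exp (1 / 8) with hK
  have hK0 : 0 ≤ K := by positivity
  have hpt : ∀ z x : EuclideanSpace ℝ (Fin n), x ∈ ball z (√t) →
      gaussKernel t (y - z) ≤ K * gaussKernel (2 * t) (y - x) := by
    intro z x hx
    have hxz : ‖z - x‖ ^ 2 ≤ t := by
      rw [mem_ball, dist_comm, dist_eq_norm] at hx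
      calc ‖z - x‖ ^ 2 ≤ √t ^ 2 := by gcongr
        _ = t := Real.sq_sqrt ht.le
    have htri : ‖y - x‖ ^ 2 ≤ 2 * ‖y - z‖ ^ 2 + 2 * t := by
      have h1 : ‖y - x‖ ≤ ‖y - z‖ + ‖z - x‖ := by
        simpa using norm_add_le (y - z) (z - x)
      have h2 : ‖y - x‖ ^ 2 ≤ (‖y - z‖ + ‖z - x‖) ^ 2 := by gcongr
      nlinarith [sq_nonneg (‖y - z‖ - ‖z - x‖)]
    have hexp : Real.exp (-‖y - z‖ ^ 2 / (8 * t)) ≤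
        Real.exp (1 / 8) * Real.exp (-‖y - x‖ ^ 2 / (8 * (2 * t))) := by
      rw [← Real.exp_add, Real.exp_le_exp]
      rw [show (1 : ℝ) / 8 + -‖y - x‖ ^ 2 / (8 * (2 * t)) =
        (2 * t - ‖y - x‖ ^ 2) / (16 * t) by field_simp; ring,
        show -‖y - z‖ ^ 2 / (8 * t) = -(2 * ‖y - z‖ ^ 2) / (16 * t) by field_simp; ring]
      gcongr
      linarith
    have hconst : (1 / (8 * π * t)) ^ ((n : ℝ) / 2) =
        2 ^ ((n : ℝ) / 2) * (1 / (8 * π * (2 * t))) ^ ((n : ℝ) / 2) := by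
      rw [← Real.mul_rpow (by positivity) (by positivity)]
      congr 1
      field_simp
    rw [gaussKernel, gaussKernel, hconst, hK]
    calc _ ≤ 2 ^ ((n : ℝ) / 2) * (1 / (8 * π * (2 * t))) ^ ((n : ℝ) / 2) *
          (Real.exp (1 / 8) * Real.exp (-‖y - x‖ ^ 2 / (8 * (2 * t)))) := by gcongr
      _ = _ := by ring
  have hvol : ∀ z : EuclideanSpace ℝ (Fin n), volume (ball z (√t)) =
      volume (ball (0 : EuclideanSpace ℝ (Fin n)) (√t)) :=
    fun z => Measure.addHaar_ball_center volume z _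
  set H : EuclideanSpace ℝ (Fin n) → ℝ≥0∞ :=
    fun x => ENNReal.ofReal (gaussKernel (2 * t) (y - x)) with hH
  have hHm : Measurable H :=
    ((continuous_gaussKernel (2 * t)).measurable.comp
      (measurable_const.sub measurable_id)).ennreal_ofReal
  have hset : MeasurableSet {p : EuclideanSpace ℝ (Fin n) × EuclideanSpace ℝ (Fin n) |
      dist p.2 p.1 < √t} :=
    measurableSet_lt (measurable_snd.dist measurable_fst) measurable_const
  have hind : ∀ z x : EuclideanSpace ℝ (Fin n), (ball z (√t)).indicator H x =
      {p : EuclideanSpace ℝ (Fin n) × EuclideanSpace ℝ (Fin n) | dist p.2 p.1 < √t}.indicator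
        (fun p => H p.2) (z, x) := fun z x => by
    simp [Set.indicator, mem_ball]
  have hind' : ∀ z x : EuclideanSpace ℝ (Fin n), (ball z (√t)).indicator H x =
      (ball x (√t)).indicator (fun _ => H x) z := fun z x => by
    simp [Set.indicator, mem_ball, dist_comm]
  calc (∫⁻ z, ENNReal.ofReal (gaussKernel t (y - z)) ∂ρ) *
        volume (ball (0 : EuclideanSpace ℝ (Fin n)) (√t))
      = ∫⁻ z, (∫⁻ _ in ball z (√t), ENNReal.ofReal (gaussKernel t (y - z))) ∂ρ := by
        rw [← lintegral_mul_const' _ _ measure_ball_lt_top.ne]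
        simp only [lintegral_const, Measure.restrict_apply_univ, hvol]
    _ ≤ ∫⁻ z, (∫⁻ x in ball z (√t), ENNReal.ofReal K * H x) ∂ρ := by
        refine lintegral_mono fun z => setLIntegral_mono (hHm.const_mul _) fun x hx => ?_
        rw [hH, ← ENNReal.ofReal_mul hK0]
        exact ENNReal.ofReal_le_ofReal (hpt z x hx)
    _ = ENNReal.ofReal K * ∫⁻ z, (∫⁻ x, (ball z (√t)).indicator H x) ∂ρ := by
        rw [← lintegral_const_mul' _ _ ENNReal.ofReal_ne_top]
        refine lintegral_congr fun z => ?_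
        rw [lintegral_const_mul' _ _ ENNReal.ofReal_ne_top, lintegral_indicator measurableSet_ball]
    _ = ENNReal.ofReal K * ∫⁻ x, (∫⁻ z, (ball z (√t)).indicator H x ∂ρ) := by
        rw [lintegral_lintegral_swap]
        simp only [hind, Function.uncurry_def]
        exact ((hHm.comp measurable_snd).indicator hset).aemeasurable
    _ ≤ ENNReal.ofReal K * ∫⁻ x, H x * M := by
        gcongr with x
        simp only [hind']
        rw [lintegral_indicator_const measurableSet_ball]
        gcongr
        exact hM x
    _ = ENNReal.ofReal K * M := by
        rw [lintegral_mul_const _ hHm, lintegral_gaussKernel (by positivity), one_mul]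

open Set in
/-- The mass of `f` in a parabolic cylinder is controlled by `𝖩(f;α)`. -/
lemma lintegral_cylinder_le {n : ℕ} {α : ℝ} (hα : 0 ≤ α)
    (f : ℝ → EuclideanSpace ℝ (Fin n) → ℂ) {t : ℝ} (ht : t ∈ Ioo (0 : ℝ) 1)
    (x : EuclideanSpace ℝ (Fin n)) :
    ∫⁻ s in Ioo 0 t, ∫⁻ y in ball x (√t), ‖f s y‖ₑ ≤
      ENNReal.ofReal (√t ^ n) * Jquant n α f := by
  have hs : 0 < √t := Real.sqrt_pos.2 ht.1
  have hs1 : √t < 1 := by rw [Real.sqrt_lt' (zero_lt_one' ℝ)]; simpa using ht.2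
  have hJ : ENNReal.ofReal (√t ^ (2 * α - (n : ℝ))) *
      ∫⁻ s in Ioo (0 : ℝ) (√t ^ 2),
        (∫⁻ y in ball x (√t), ‖f s y‖ₑ) * ENNReal.ofReal (s ^ (-α)) ≤ Jquant n α f :=
    le_iSup₂_of_le (√t) ⟨hs, hs1⟩ (le_iSup_of_le x le_rfl)
  rw [Real.sq_sqrt ht.1.le] at hJ
  have hexp : √t ^ n * √t ^ (2 * α - (n : ℝ)) * t ^ (-α) = 1 := by
    have h2 : t ^ (-α) = √t ^ (-(2 * α)) := by
      conv_lhs => rw [← Real.sq_sqrt ht.1.le]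
      rw [← Real.rpow_natCast_mul hs.le]
      congr 1
      push_cast
      ring
    rw [h2, ← Real.rpow_natCast, ← Real.rpow_add hs, ← Real.rpow_add hs]
    simp
  calc ∫⁻ s in Ioo 0 t, ∫⁻ y in ball x (√t), ‖f s y‖ₑ
      = ENNReal.ofReal (√t ^ n * √t ^ (2 * α - (n : ℝ))) *
        ∫⁻ s in Ioo 0 t, (∫⁻ y in ball x (√t), ‖f s y‖ₑ) * ENNReal.ofReal (t ^ (-α)) := by
        rw [lintegral_mul_const' _ _ ENNReal.ofReal_ne_top, mul_comm _ (ENNReal.ofReal (t ^ (-α))),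
          ← mul_assoc, ← ENNReal.ofReal_mul (by positivity), hexp, ENNReal.ofReal_one, one_mul]
    _ ≤ ENNReal.ofReal (√t ^ n * √t ^ (2 * α - (n : ℝ))) *
        ∫⁻ s in Ioo 0 t, (∫⁻ y in ball x (√t), ‖f s y‖ₑ) * ENNReal.ofReal (s ^ (-α)) := by
        refine mul_le_mul' le_rfl (setLIntegral_mono' measurableSet_Ioo fun s hs' => ?_)
        exact mul_le_mul' le_rfl (ENNReal.ofReal_le_ofReal
          (Real.rpow_le_rpow_of_nonpos hs'.1 hs'.2.le (by linarith)))
    _ ≤ ENNReal.ofReal (√t ^ n) * Jquant n α f := by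
        rw [ENNReal.ofReal_mul (by positivity), mul_assoc]
        gcongr

/-- Lebesgue measure on the slab `(0,t)×ℝⁿ`. -/
def slab (n : ℕ) (t : ℝ) : Measure (ℝ × EuclideanSpace ℝ (Fin n)) :=
  (volume.restrict (Set.Ioo 0 t)).prod volume

instance {n : ℕ} {t : ℝ} : SFinite (slab n t) := by
  unfold slab
  infer_instance

/-- The constant in the bound of heat potentials by `𝖩(f;α)`. -/
def heatConst (n : ℕ) : ℝ≥0∞ :=
  ENNReal.ofReal (2 ^ ((n : ℝ) / 2) * Real.exp (1 / 8)) /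
    volume (ball (0 : EuclideanSpace ℝ (Fin n)) 1)

lemma heatConst_ne_top (n : ℕ) : heatConst n ≠ ⊤ :=
  ENNReal.div_ne_top ENNReal.ofReal_ne_top (measure_ball_pos _ _ one_pos).ne'

lemma heatConst_ne_zero (n : ℕ) : heatConst n ≠ 0 := by
  rw [heatConst, ENNReal.div_ne_zero]
  refine ⟨?_, measure_ball_lt_top.ne⟩
  rw [Ne, ENNReal.ofReal_eq_zero, not_le]
  positivity

open Set in
/-- The heat potential `e^{2tΔ} ∫_0^t |f(s,·)| ds` is bounded by `𝖩(f;α)`. -/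
lemma lintegral_slab_gaussKernel_le {n : ℕ} {α : ℝ} (hα : 0 ≤ α)
    {f : ℝ → EuclideanSpace ℝ (Fin n) → ℂ} (hf : Measurable (Function.uncurry f)) {t : ℝ}
    (ht : t ∈ Ioo (0 : ℝ) 1) (y : EuclideanSpace ℝ (Fin n)) :
    ∫⁻ p, ‖f p.1 p.2‖ₑ * ENNReal.ofReal (gaussKernel t (y - p.2)) ∂(slab n t) ≤
      heatConst n * Jquant n α f := by
  have hfe : Measurable fun p : ℝ × EuclideanSpace ℝ (Fin n) => ‖f p.1 p.2‖ₑ := hf.enorm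
  have hG : Measurable fun z : EuclideanSpace ℝ (Fin n) =>
      ENNReal.ofReal (gaussKernel t (y - z)) :=
    ((continuous_gaussKernel t).measurable.comp
      (measurable_const.sub measurable_id)).ennreal_ofReal
  set ρ : Measure (EuclideanSpace ℝ (Fin n)) :=
    ((slab n t).withDensity fun p => ‖f p.1 p.2‖ₑ).map Prod.snd with hρ
  have hball : ∀ x, ρ (ball x (√t)) ≤ ENNReal.ofReal (√t ^ n) * Jquant n α f := by
    intro x
    rw [hρ, Measure.map_apply measurable_snd measurableSet_ball,
      withDensity_apply _ (measurable_snd measurableSet_ball), ← univ_prod, slab,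
      ← Measure.prod_restrict, Measure.restrict_univ, lintegral_prod _ hfe.aemeasurable]
    exact lintegral_cylinder_le hα f ht x
  have key := lintegral_gaussKernel_mul_volume_le ρ ht.1 hball y
  have hvol : volume (ball (0 : EuclideanSpace ℝ (Fin n)) (√t)) =
      ENNReal.ofReal (√t ^ n) * volume (ball (0 : EuclideanSpace ℝ (Fin n)) 1) := by
    rw [Measure.addHaar_ball_of_pos volume _ (Real.sqrt_pos.2 ht.1), finrank_euclideanSpace_fin]
  have hr0 : ENNReal.ofReal (√t ^ n) ≠ 0 := by
    rw [Ne, ENNReal.ofReal_eq_zero, not_le]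
    exact pow_pos (Real.sqrt_pos.2 ht.1) _
  have hv0 : volume (ball (0 : EuclideanSpace ℝ (Fin n)) 1) ≠ 0 :=
    (measure_ball_pos _ _ one_pos).ne'
  have hv1 : volume (ball (0 : EuclideanSpace ℝ (Fin n)) 1) ≠ ⊤ := measure_ball_lt_top.ne
  have hint : ∫⁻ z, ENNReal.ofReal (gaussKernel t (y - z)) ∂ρ =
      ∫⁻ p, ‖f p.1 p.2‖ₑ * ENNReal.ofReal (gaussKernel t (y - p.2)) ∂(slab n t) := by
    rw [hρ, lintegral_map hG measurable_snd]
    exact lintegral_withDensity_eq_lintegral_mul _ hfe (hG.comp measurable_snd)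
  rw [hint, hvol, mul_left_comm, mul_left_comm _ (ENNReal.ofReal (√t ^ n)),
    ENNReal.mul_le_mul_iff_right hr0 ENNReal.ofReal_ne_top] at key
  rw [heatConst, ENNReal.mul_comm_div, ← mul_div_assoc]
  rwa [ENNReal.le_div_iff_mul_le (Or.inl hv0) (Or.inl hv1)]

lemma spaceFourier_eq {n : ℕ} (f : ℝ → EuclideanSpace ℝ (Fin n) → ℂ) (s : ℝ)
    (ζ : EuclideanSpace ℝ (Fin n)) :
    spaceFourier n f s ζ = ∫ y, f s y * planeWave y ζ := rfl

lemma measurable_spaceFourier {n : ℕ} {f : ℝ → EuclideanSpace ℝ (Fin n) → ℂ}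
    (hf : Measurable (Function.uncurry f)) :
    Measurable fun p : ℝ × EuclideanSpace ℝ (Fin n) => spaceFourier n f p.1 p.2 := by
  have hf' : Measurable fun q : (ℝ × EuclideanSpace ℝ (Fin n)) × EuclideanSpace ℝ (Fin n) =>
      f q.1.1 q.2 :=
    hf.comp (measurable_fst.fst.prodMk measurable_snd)
  have hp : Measurable fun q : (ℝ × EuclideanSpace ℝ (Fin n)) × EuclideanSpace ℝ (Fin n) =>
      planeWave q.2 q.1.2 := by
    unfold planeWave
    fun_prop
  have h : Measurable fun q : (ℝ × EuclideanSpace ℝ (Fin n)) × EuclideanSpace ℝ (Fin n) =>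
      f q.1.1 q.2 * planeWave q.2 q.1.2 := hf'.mul hp
  have h2 := (h.stronglyMeasurable.integral_prod_right' (ν := volume)).measurable
  simpa only [spaceFourier_eq] using h2

lemma measurable_primitive_spaceFourier {n : ℕ} {f : ℝ → EuclideanSpace ℝ (Fin n) → ℂ}
    (hf : Measurable (Function.uncurry f)) :
    Measurable fun p : ℝ × EuclideanSpace ℝ (Fin n) =>
      ∫ s in Set.Ioo 0 p.1, spaceFourier n f s p.2 := by
  have hset : MeasurableSet {q : (ℝ × EuclideanSpace ℝ (Fin n)) × ℝ | 0 < q.2 ∧ q.2 < q.1.1} :=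
    (measurableSet_lt measurable_const measurable_snd).inter
      (measurableSet_lt measurable_snd measurable_fst.fst)
  have h : Measurable ({q : (ℝ × EuclideanSpace ℝ (Fin n)) × ℝ | 0 < q.2 ∧ q.2 < q.1.1}.indicator
      fun q => spaceFourier n f q.2 q.1.2) :=
    ((measurable_spaceFourier hf).comp (measurable_snd.prodMk measurable_fst.snd)).indicator hset
  have h2 := (h.stronglyMeasurable.integral_prod_right' (ν := volume)).measurable
  convert h2 using 2 with p
  rw [← integral_indicator measurableSet_Ioo]
  rfl

lemma integrable_slab_mono {n : ℕ} {g : ℝ × EuclideanSpace ℝ (Fin n) → ℂ}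
    (hg : Integrable g (slab n 1)) {t : ℝ} (ht : t ≤ 1) : Integrable g (slab n t) := by
  refine hg.mono_measure ?_
  have h : (volume.restrict (Set.Ioo 0 t)).prod (volume : Measure (EuclideanSpace ℝ (Fin n))) ≤
      (volume.restrict (Set.Ioo 0 1)).prod volume :=
    Measure.prod_mono (Measure.restrict_mono (Set.Ioo_subset_Ioo_right ht) le_rfl) le_rfl
  exact h

lemma integrable_slab_mul_planeWave {n : ℕ} {f : ℝ → EuclideanSpace ℝ (Fin n) → ℂ} {t : ℝ}
    (hf : Integrable (Function.uncurry f) (slab n t)) (ζ : EuclideanSpace ℝ (Fin n)) :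
    Integrable (fun p : ℝ × EuclideanSpace ℝ (Fin n) => f p.1 p.2 * planeWave p.2 ζ)
      (slab n t) := by
  refine hf.mul_bdd (c := 1) ?_ (Filter.Eventually.of_forall fun p => (norm_planeWave _ _).le)
  exact (continuous_planeWave.measurable.comp
    (measurable_snd.prodMk measurable_const)).aestronglyMeasurable

lemma integrableOn_spaceFourier {n : ℕ} {f : ℝ → EuclideanSpace ℝ (Fin n) → ℂ} {t : ℝ}
    (hf : Integrable (Function.uncurry f) (slab n t)) (ζ : EuclideanSpace ℝ (Fin n)) :
    IntegrableOn (fun s => spaceFourier n f s ζ) (Set.Ioo 0 t) :=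
  (integrable_slab_mul_planeWave hf ζ).integral_prod_left

lemma primitive_spaceFourier_eq {n : ℕ} {f : ℝ → EuclideanSpace ℝ (Fin n) → ℂ} {t : ℝ}
    (hf : Integrable (Function.uncurry f) (slab n t)) (ζ : EuclideanSpace ℝ (Fin n)) :
    ∫ s in Set.Ioo 0 t, spaceFourier n f s ζ =
      ∫ p, f p.1 p.2 * planeWave p.2 ζ ∂(slab n t) :=
  (integral_prod _ (integrable_slab_mul_planeWave hf ζ)).symm

lemma norm_spaceFourier_le {n : ℕ} (f : ℝ → EuclideanSpace ℝ (Fin n) → ℂ) (s : ℝ)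
    (ζ : EuclideanSpace ℝ (Fin n)) : ‖spaceFourier n f s ζ‖ ≤ ∫ y, ‖f s y‖ := by
  rw [spaceFourier_eq]
  refine (norm_integral_le_integral_norm _).trans_eq ?_
  simp only [norm_mul, norm_planeWave, mul_one]

lemma norm_primitive_spaceFourier_le {n : ℕ} {f : ℝ → EuclideanSpace ℝ (Fin n) → ℂ}
    (hf : Integrable (Function.uncurry f) (slab n 1)) {t : ℝ} (ht : t ≤ 1)
    (ζ : EuclideanSpace ℝ (Fin n)) :
    ‖∫ s in Set.Ioo 0 t, spaceFourier n f s ζ‖ ≤ ∫ s in Set.Ioo 0 1, ∫ y, ‖f s y‖ := by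
  have hN : IntegrableOn (fun s => ∫ y, ‖f s y‖) (Set.Ioo 0 1) := hf.norm.integral_prod_left
  have hsub : Set.Ioo (0 : ℝ) t ⊆ Set.Ioo 0 1 := Set.Ioo_subset_Ioo_right ht
  calc ‖∫ s in Set.Ioo 0 t, spaceFourier n f s ζ‖
      ≤ ∫ s in Set.Ioo 0 t, ∫ y, ‖f s y‖ :=
        norm_integral_le_of_norm_le (hN.mono_set hsub)
          (Filter.Eventually.of_forall fun s => norm_spaceFourier_le f s ζ)
    _ ≤ ∫ s in Set.Ioo 0 1, ∫ y, ‖f s y‖ :=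
        setIntegral_mono_set hN (Filter.Eventually.of_forall fun s =>
          integral_nonneg fun y => norm_nonneg _) hsub.eventuallyLE

/-- A time slice of the solution paired with an integrable function. -/
lemma enorm_integral_exp_mul_fourier_mul_primitive_le {n : ℕ} {α : ℝ} (hα : 0 ≤ α)
    {f : ℝ → EuclideanSpace ℝ (Fin n) → ℂ} (hf : Measurable (Function.uncurry f)) {t : ℝ}
    (ht : t ∈ Set.Ioo (0 : ℝ) 1) (hI : Integrable (Function.uncurry f) (slab n 1))
    {X : Type*} [MeasurableSpace X] {μ : Measure X} [SFinite μ] {g : X → ℂ}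
    (hg : Integrable g μ) {u : X → EuclideanSpace ℝ (Fin n)} (hu : Measurable u) :
    ‖∫ ζ, (Real.exp (-(8 * π ^ 2 * t) * ‖ζ‖ ^ 2) : ℂ) * ((∫ x, g x * planeWave (u x) ζ ∂μ) *
      (starRingEnd ℂ) (∫ s in Set.Ioo 0 t, spaceFourier n f s ζ))‖ₑ ≤
      (∫⁻ x, ‖g x‖ₑ ∂μ) * (heatConst n * Jquant n α f) := by
  have hIt := integrable_slab_mono hI ht.2.le
  simp only [primitive_spaceFourier_eq hIt]
  refine (enorm_integral_exp_mul_fourier_mul_conj_le hg hIt hu measurable_snd ht.1).trans ?_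
  rw [← lintegral_mul_const'' _ hg.1.enorm]
  refine lintegral_mono fun x => ?_
  gcongr
  exact lintegral_slab_gaussKernel_le hα hf ht (u x)

lemma enorm_integral_boundary_le {n : ℕ} {α : ℝ} (hα : 0 ≤ α)
    {f : ℝ → EuclideanSpace ℝ (Fin n) → ℂ} (hf : Measurable (Function.uncurry f)) {ε : ℝ}
    (hε : ε ∈ Set.Ioo (0 : ℝ) 1) (hI : Integrable (Function.uncurry f) (slab n 1)) :
    ‖∫ ζ, ε ^ (-α) * (Real.exp (-(8 * π ^ 2 * ε) * ‖ζ‖ ^ 2) *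
        ‖∫ s in Set.Ioo 0 ε, spaceFourier n f s ζ‖ ^ 2)‖ₑ ≤
      (∫⁻ s in Set.Ioo 0 ε, (∫⁻ y, ‖f s y‖ₑ) * ENNReal.ofReal (s ^ (-α))) *
        (heatConst n * Jquant n α f) := by
  have hIε := integrable_slab_mono hI hε.2.le
  have key := enorm_integral_exp_mul_fourier_mul_primitive_le hα hf hε hI hIε measurable_snd
  have e2 : ∫ ζ, (Real.exp (-(8 * π ^ 2 * ε) * ‖ζ‖ ^ 2) : ℂ) *
      ((∫ p, Function.uncurry f p * planeWave p.2 ζ ∂(slab n ε)) *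
        (starRingEnd ℂ) (∫ s in Set.Ioo 0 ε, spaceFourier n f s ζ)) =
      ((∫ ζ, Real.exp (-(8 * π ^ 2 * ε) * ‖ζ‖ ^ 2) *
        ‖∫ s in Set.Ioo 0 ε, spaceFourier n f s ζ‖ ^ 2 : ℝ) : ℂ) := by
    rw [← integral_complex_ofReal]
    congr 1
    ext ζ
    have h := primitive_spaceFourier_eq hIε ζ
    simp only [Function.uncurry]
    rw [← h, Complex.mul_conj, Complex.normSq_eq_norm_sq]
    push_cast
    rfl
  have e3 : ∫⁻ p, ‖Function.uncurry f p‖ₑ ∂(slab n ε) =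
      ∫⁻ s in Set.Ioo 0 ε, ∫⁻ y, ‖f s y‖ₑ :=
    lintegral_prod _ hf.enorm.aemeasurable
  rw [e2, e3, ← ofReal_norm, Complex.norm_real, ofReal_norm] at key
  rw [integral_const_mul, enorm_mul, Real.enorm_of_nonneg (Real.rpow_nonneg hε.1.le _)]
  refine (mul_le_mul' le_rfl key).trans ?_
  rw [← mul_assoc, mul_comm (ENNReal.ofReal _), ← lintegral_mul_const' _ _ ENNReal.ofReal_ne_top]
  refine mul_le_mul' (setLIntegral_mono' measurableSet_Ioo fun s hs => ?_) le_rfl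
  exact mul_le_mul' le_rfl (ENNReal.ofReal_le_ofReal
    (Real.rpow_le_rpow_of_nonpos hs.1 hs.2.le (by linarith)))

lemma integrable_fourier_mul_primitive {n : ℕ} {α : ℝ} (hα : 0 ≤ α)
    {f : ℝ → EuclideanSpace ℝ (Fin n) → ℂ} (hf : Measurable (Function.uncurry f)) {ε : ℝ}
    (hε : 0 < ε) (hI : Integrable (Function.uncurry f) (slab n 1)) :
    Integrable (fun p : EuclideanSpace ℝ (Fin n) × ℝ =>
      ((p.2 ^ (-α) * Real.exp (-(8 * π ^ 2 * p.2) * ‖p.1‖ ^ 2) : ℝ) : ℂ) *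
        (spaceFourier n f p.2 p.1 *
          (starRingEnd ℂ) (∫ s in Set.Ioo 0 p.2, spaceFourier n f s p.1)))
      (volume.prod (volume.restrict (Set.Ioo ε 1))) := by
  have hN : IntegrableOn (fun s => ∫ y, ‖f s y‖) (Set.Ioo ε 1) :=
    IntegrableOn.mono_set (hI.norm.integral_prod_left) (Set.Ioo_subset_Ioo_left hε.le)
  have hG := integrable_exp_neg_mul_sq_norm (n := n) (b := 8 * π ^ 2 * ε) (by positivity)
  have hdom := (hG.mul_prod hN).const_mul (ε ^ (-α) * ∫ s in Set.Ioo 0 1, ∫ y, ‖f s y‖)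
  refine hdom.mono' ?_ ?_
  · have h1 := (measurable_spaceFourier hf).comp
      (measurable_swap (α := EuclideanSpace ℝ (Fin n)) (β := ℝ))
    have h2 := (measurable_primitive_spaceFourier hf).comp
      (measurable_swap (α := EuclideanSpace ℝ (Fin n)) (β := ℝ))
    have h3 : Measurable fun p : EuclideanSpace ℝ (Fin n) × ℝ =>
        ((p.2 ^ (-α) * Real.exp (-(8 * π ^ 2 * p.2) * ‖p.1‖ ^ 2) : ℝ) : ℂ) := by fun_prop
    exact (h3.mul (h1.mul (Complex.continuous_conj.measurable.comp h2))).aestronglyMeasurable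
  · have hmem : ∀ᵐ p ∂((volume : Measure (EuclideanSpace ℝ (Fin n))).prod
        (volume.restrict (Set.Ioo ε 1))), p.2 ∈ Set.Ioo ε 1 :=
      Measure.quasiMeasurePreserving_snd.ae (ae_restrict_mem measurableSet_Ioo)
    filter_upwards [hmem] with p hp
    have hp0 : 0 < p.2 := hε.trans hp.1
    rw [norm_mul, norm_mul, RCLike.norm_conj, Complex.norm_real, Real.norm_of_nonneg (by positivity)]
    have b1 : p.2 ^ (-α) ≤ ε ^ (-α) :=
      Real.rpow_le_rpow_of_nonpos hε hp.1.le (by linarith)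
    have b2 : Real.exp (-(8 * π ^ 2 * p.2) * ‖p.1‖ ^ 2) ≤
        Real.exp (-(8 * π ^ 2 * ε) * ‖p.1‖ ^ 2) := by
      gcongr
      exact hp.1.le
    have b3 := norm_spaceFourier_le f p.2 p.1
    have b4 := norm_primitive_spaceFourier_le hI hp.2.le p.1
    calc _ ≤ ε ^ (-α) * Real.exp (-(8 * π ^ 2 * ε) * ‖p.1‖ ^ 2) *
          ((∫ y, ‖f p.2 y‖) * ∫ s in Set.Ioo 0 1, ∫ y, ‖f s y‖) := by
          have : 0 ≤ ∫ y, ‖f p.2 y‖ := integral_nonneg fun y => norm_nonneg _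
          gcongr
      _ = _ := by ring

lemma enorm_integral_source_le {n : ℕ} {α : ℝ} (hα : 0 ≤ α)
    {f : ℝ → EuclideanSpace ℝ (Fin n) → ℂ} (hf : Measurable (Function.uncurry f)) {ε : ℝ}
    (hε : 0 < ε) (hI : Integrable (Function.uncurry f) (slab n 1)) :
    ‖∫ ζ, ∫ t in Set.Ioo ε 1, t ^ (-α) * Real.exp (-(8 * π ^ 2 * t) * ‖ζ‖ ^ 2) *
        (spaceFourier n f t ζ *
          (starRingEnd ℂ) (∫ s in Set.Ioo 0 t, spaceFourier n f s ζ)).re‖ₑ ≤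
      (∫⁻ t in Set.Ioo ε 1, (∫⁻ y, ‖f t y‖ₑ) * ENNReal.ofReal (t ^ (-α))) *
        (heatConst n * Jquant n α f) := by
  have hF := integrable_fourier_mul_primitive hα hf hε hI
  have hFre := hF.re
  simp only [RCLike.re_to_complex, Complex.re_ofReal_mul] at hFre
  rw [integral_integral_swap hFre]
  refine (enorm_integral_le_lintegral_enorm _).trans ?_
  have hft : ∀ᵐ t ∂(volume.restrict (Set.Ioo 0 1)), Integrable (f t) := hI.prod_right_ae
  have hft' := ae_restrict_of_ae_restrict_of_subset (Set.Ioo_subset_Ioo_left hε.le) hft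
  have hae : ∀ᵐ t ∂(volume.restrict (Set.Ioo ε 1)),
      ‖∫ ζ, t ^ (-α) * Real.exp (-(8 * π ^ 2 * t) * ‖ζ‖ ^ 2) * (spaceFourier n f t ζ *
          (starRingEnd ℂ) (∫ s in Set.Ioo 0 t, spaceFourier n f s ζ)).re‖ₑ ≤
        (∫⁻ y, ‖f t y‖ₑ) * ENNReal.ofReal (t ^ (-α)) * (heatConst n * Jquant n α f) := by
    filter_upwards [hft', hF.prod_left_ae, ae_restrict_mem measurableSet_Ioo] with t h1 h2 ht
    have ht0 : 0 < t := hε.trans ht.1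
    have key := enorm_integral_exp_mul_fourier_mul_primitive_le hα hf ⟨ht0, ht.2⟩ hI h1
      measurable_id
    have e := integral_re h2
    simp only [RCLike.re_to_complex, Complex.re_ofReal_mul] at e
    rw [e]
    have e2 : ∫ ζ, ((t ^ (-α) * Real.exp (-(8 * π ^ 2 * t) * ‖ζ‖ ^ 2) : ℝ) : ℂ) *
        (spaceFourier n f t ζ *
          (starRingEnd ℂ) (∫ s in Set.Ioo 0 t, spaceFourier n f s ζ)) =
        ((t ^ (-α) : ℝ) : ℂ) * ∫ ζ, (Real.exp (-(8 * π ^ 2 * t) * ‖ζ‖ ^ 2) : ℂ) *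
        (spaceFourier n f t ζ *
          (starRingEnd ℂ) (∫ s in Set.Ioo 0 t, spaceFourier n f s ζ)) := by
      rw [← integral_const_mul]
      congr 1
      ext ζ
      rw [Complex.ofReal_mul, mul_assoc]
    rw [e2, Complex.re_ofReal_mul, enorm_mul, Real.enorm_of_nonneg (Real.rpow_nonneg ht0.le _),
      mul_comm (∫⁻ y, ‖f t y‖ₑ), mul_assoc (ENNReal.ofReal _)]
    refine mul_le_mul' le_rfl (le_trans ?_ key)
    rw [← ofReal_norm, ← ofReal_norm]
    exact ENNReal.ofReal_le_ofReal (Complex.abs_re_le_norm _)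
  refine (lintegral_mono_ae hae).trans_eq (lintegral_mul_const _ ?_)
  exact (hf.enorm.lintegral_prod_right' (ν := volume)).mul (by fun_prop)

/-- The weighted energy estimate on `(ε,1)`. -/
lemma lintegral_Ioo_heat_energy_le {n : ℕ} {α : ℝ} (hα : 0 ≤ α)
    {f : ℝ → EuclideanSpace ℝ (Fin n) → ℂ} (hf : Measurable (Function.uncurry f)) {ε : ℝ}
    (hε : ε ∈ Set.Ioo (0 : ℝ) 1) (hI : Integrable (Function.uncurry f) (slab n 1)) :
    ∫⁻ t in Set.Ioo ε 1,
        (∫⁻ ζ, ENNReal.ofReal ((2 * π * ‖ζ‖) ^ 2 * Real.exp (-8 * π ^ 2 * t * ‖ζ‖ ^ 2)) *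
          ‖∫ s in Set.Ioo 0 t, spaceFourier n f s ζ‖ₑ ^ 2) * ENNReal.ofReal (t ^ (-α)) ≤
      heatConst n * Jquant n α f *
        ∫⁻ t in Set.Ioo 0 1, (∫⁻ y, ‖f t y‖ₑ) * ENNReal.ofReal (t ^ (-α)) := by
  set a : ℝ → EuclideanSpace ℝ (Fin n) → ℂ := fun t ζ => ∫ s in Set.Ioo 0 t, spaceFourier n f s ζ
    with ha
  set P : EuclideanSpace ℝ (Fin n) → ℝ → ℝ := fun ζ t =>
    8 * π ^ 2 * ‖ζ‖ ^ 2 * Real.exp (-(8 * π ^ 2 * ‖ζ‖ ^ 2) * t) * t ^ (-α) * ‖a t ζ‖ ^ 2 with hP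
  set A : EuclideanSpace ℝ (Fin n) → ℝ := fun ζ =>
    ε ^ (-α) * (Real.exp (-(8 * π ^ 2 * ε) * ‖ζ‖ ^ 2) * ‖a ε ζ‖ ^ 2) with hA
  set B : EuclideanSpace ℝ (Fin n) → ℝ → ℝ := fun ζ t =>
    t ^ (-α) * Real.exp (-(8 * π ^ 2 * t) * ‖ζ‖ ^ 2) *
      (spaceFourier n f t ζ * (starRingEnd ℂ) (a t ζ)).re with hB
  set S : ℝ := ∫ s in Set.Ioo 0 1, ∫ y, ‖f s y‖ with hS
  have ham : Measurable fun p : ℝ × EuclideanSpace ℝ (Fin n) => a p.1 p.2 :=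
    measurable_primitive_spaceFourier hf
  have haS : ∀ t ≤ 1, ∀ ζ, ‖a t ζ‖ ≤ S := fun t ht ζ => norm_primitive_spaceFourier_le hI ht ζ
  have hPm : Measurable fun p : ℝ × EuclideanSpace ℝ (Fin n) => P p.2 p.1 := by
    have := (ham.norm).pow_const 2
    simp only [hP]
    fun_prop
  have hP0 : ∀ ζ, ∀ t ∈ Set.Ioo ε 1, 0 ≤ P ζ t := fun ζ t ht => by
    have : 0 < t := hε.1.trans ht.1
    positivity
  have hPint : ∀ ζ, IntegrableOn (P ζ) (Set.Ioo ε 1) := fun ζ => by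
    refine Integrable.of_bound (hPm.comp measurable_prodMk_right).aestronglyMeasurable
      (8 * π ^ 2 * ‖ζ‖ ^ 2 * 1 * ε ^ (-α) * S ^ 2) ?_
    filter_upwards [ae_restrict_mem measurableSet_Ioo] with t ht
    have ht0 : 0 < t := hε.1.trans ht.1
    rw [Real.norm_of_nonneg (hP0 ζ t ht)]
    have b1 : t ^ (-α) ≤ ε ^ (-α) :=
      Real.rpow_le_rpow_of_nonpos hε.1 ht.1.le (by linarith)
    have b2 : Real.exp (-(8 * π ^ 2 * ‖ζ‖ ^ 2) * t) ≤ 1 := by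
      rw [Real.exp_le_one_iff, neg_mul, neg_nonpos]
      positivity
    have b3 := haS t ht.2.le ζ
    have hε0 := hε.1
    simp only [hP]
    gcongr
  have hAint : Integrable A := by
    have hG := integrable_exp_neg_mul_sq_norm (n := n) (b := 8 * π ^ 2 * ε)
      (by have := hε.1; positivity)
    refine (hG.const_mul (ε ^ (-α) * S ^ 2)).mono' ?_ (Filter.Eventually.of_forall fun ζ => ?_)
    · have : Measurable (a ε) := ham.comp measurable_prodMk_left
      exact Measurable.aestronglyMeasurable (by fun_prop)
    · have hε0 := hε.1
      have b3 := haS ε hε.2.le ζ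
      rw [Real.norm_of_nonneg (by positivity)]
      calc A ζ ≤ ε ^ (-α) * (Real.exp (-(8 * π ^ 2 * ε) * ‖ζ‖ ^ 2) * S ^ 2) := by
            simp only [hA]
            gcongr
        _ = _ := by ring
  have hBint : Integrable fun ζ => ∫ t in Set.Ioo ε 1, B ζ t := by
    have hFre := (integrable_fourier_mul_primitive hα hf hε.1 hI).re
    simp only [RCLike.re_to_complex, Complex.re_ofReal_mul] at hFre
    exact hFre.integral_prod_left
  have hen : ∀ ζ, ∫ t in Set.Ioo ε 1, P ζ t ≤ A ζ + 2 * ∫ t in Set.Ioo ε 1, B ζ t := fun ζ => by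
    have h := weighted_energy_le (c := 8 * π ^ 2 * ‖ζ‖ ^ 2) hα hε.1 hε.2
      (integrableOn_spaceFourier hI ζ)
    have e : ∀ t : ℝ, -(8 * π ^ 2 * ‖ζ‖ ^ 2) * t = -(8 * π ^ 2 * t) * ‖ζ‖ ^ 2 := fun t => by ring
    refine h.trans_eq ?_
    simp only [hA, hB, e, ha, mul_assoc (ε ^ (-α))]
  have hPnn : ∀ ζ, 0 ≤ ∫ t in Set.Ioo ε 1, P ζ t := fun ζ =>
    setIntegral_nonneg measurableSet_Ioo (hP0 ζ)
  have hlhs : ∫⁻ t in Set.Ioo ε 1,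
        (∫⁻ ζ, ENNReal.ofReal ((2 * π * ‖ζ‖) ^ 2 * Real.exp (-8 * π ^ 2 * t * ‖ζ‖ ^ 2)) *
          ‖a t ζ‖ₑ ^ 2) * ENNReal.ofReal (t ^ (-α)) =
      ∫⁻ ζ, ENNReal.ofReal ((∫ t in Set.Ioo ε 1, P ζ t) / 2) := by
    calc _ = ∫⁻ t in Set.Ioo ε 1, ∫⁻ ζ, ENNReal.ofReal (P ζ t / 2) := by
          refine setLIntegral_congr_fun measurableSet_Ioo fun t ht => ?_
          have ht0 : 0 < t := hε.1.trans ht.1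
          rw [← lintegral_mul_const' _ _ ENNReal.ofReal_ne_top]
          refine lintegral_congr fun ζ => ?_
          rw [← ofReal_norm, ← ENNReal.ofReal_pow (norm_nonneg _),
            ← ENNReal.ofReal_mul (by positivity), ← ENNReal.ofReal_mul (by positivity)]
          congr 1
          simp only [hP]
          rw [show -8 * π ^ 2 * t * ‖ζ‖ ^ 2 = -(8 * π ^ 2 * ‖ζ‖ ^ 2) * t by ring]
          ring
      _ = ∫⁻ ζ, ∫⁻ t in Set.Ioo ε 1, ENNReal.ofReal (P ζ t / 2) :=
          lintegral_lintegral_swap (hPm.div_const 2).ennreal_ofReal.aemeasurable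
      _ = _ := by
          refine lintegral_congr fun ζ => ?_
          rw [← integral_div, ofReal_integral_eq_lintegral_ofReal ((hPint ζ).div_const 2)]
          filter_upwards [ae_restrict_mem measurableSet_Ioo] with t ht
          exact div_nonneg (hP0 ζ t ht) zero_le_two
  set N : ℝ → ℝ≥0∞ := fun t => (∫⁻ y, ‖f t y‖ₑ) * ENNReal.ofReal (t ^ (-α)) with hN
  have hA_le := enorm_integral_boundary_le hα hf hε hI
  have hB_le := enorm_integral_source_le hα hf hε.1 hI
  rw [hlhs]
  calc ∫⁻ ζ, ENNReal.ofReal ((∫ t in Set.Ioo ε 1, P ζ t) / 2)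
      ≤ ∫⁻ ζ, ENNReal.ofReal (A ζ / 2 + ∫ t in Set.Ioo ε 1, B ζ t) := by
        refine lintegral_mono fun ζ => ENNReal.ofReal_le_ofReal ?_
        linarith [hen ζ]
    _ = ENNReal.ofReal (∫ ζ, (A ζ / 2 + ∫ t in Set.Ioo ε 1, B ζ t)) := by
        refine (ofReal_integral_eq_lintegral_ofReal ((hAint.div_const 2).add hBint) ?_).symm
        refine Filter.Eventually.of_forall fun ζ => ?_
        have := (hPnn ζ).trans (hen ζ)
        simp only [Pi.zero_apply, Pi.add_apply]
        linarith
    _ ≤ ENNReal.ofReal (∫ ζ, A ζ) + ENNReal.ofReal (∫ ζ, ∫ t in Set.Ioo ε 1, B ζ t) := by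
        rw [integral_add (hAint.div_const 2) hBint, integral_div]
        refine (ENNReal.ofReal_le_ofReal ?_).trans ENNReal.ofReal_add_le
        have hA0 : 0 ≤ ∫ ζ, A ζ := integral_nonneg fun ζ => by
          have := hε.1
          simp only [hA, Pi.zero_apply]
          positivity
        linarith
    _ ≤ ‖∫ ζ, A ζ‖ₑ + ‖∫ ζ, ∫ t in Set.Ioo ε 1, B ζ t‖ₑ :=
        add_le_add (Real.ofReal_le_enorm _) (Real.ofReal_le_enorm _)
    _ ≤ (∫⁻ t in Set.Ioo 0 ε, N t) * (heatConst n * Jquant n α f) +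
        (∫⁻ t in Set.Ioo ε 1, N t) * (heatConst n * Jquant n α f) := add_le_add hA_le hB_le
    _ = heatConst n * Jquant n α f * ∫⁻ t in Set.Ioo 0 ε ∪ Set.Ioo ε 1, N t := by
        rw [lintegral_union measurableSet_Ioo, ← add_mul, mul_comm]
        exact Set.disjoint_left.2 fun t h1 h2 => lt_asymm h1.2 h2.1
    _ ≤ heatConst n * Jquant n α f * ∫⁻ t in Set.Ioo 0 1, N t := by
        gcongr
        exact Set.union_subset (Set.Ioo_subset_Ioo_right hε.2.le)
          (Set.Ioo_subset_Ioo_left hε.1.le)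

lemma iUnion_Ioo_inv_eq : ⋃ k : ℕ, Set.Ioo (1 / ((k : ℝ) + 2)) 1 = Set.Ioo 0 1 := by
  ext t
  simp only [Set.mem_iUnion, Set.mem_Ioo]
  refine ⟨fun ⟨k, h1, h2⟩ => ⟨lt_trans (by positivity) h1, h2⟩, fun ⟨h1, h2⟩ => ?_⟩
  obtain ⟨k, hk⟩ := exists_nat_one_div_lt h1
  refine ⟨k, lt_of_le_of_lt ?_ hk, h2⟩
  gcongr
  norm_num

lemma ae_lintegral_enorm_eq_zero_of_Jquant_eq_zero {n : ℕ} {α : ℝ} (hα : 0 ≤ α)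
    {f : ℝ → EuclideanSpace ℝ (Fin n) → ℂ} (hf : Measurable (Function.uncurry f))
    (hJ : Jquant n α f = 0) : ∀ᵐ s ∂(volume.restrict (Set.Ioo (0 : ℝ) 1)), ∫⁻ y, ‖f s y‖ₑ = 0 := by
  have hslice : ∀ t ∈ Set.Ioo (0 : ℝ) 1,
      ∀ᵐ s ∂(volume.restrict (Set.Ioo (0 : ℝ) t)), ∫⁻ y, ‖f s y‖ₑ = 0 := by
    intro t ht
    have hfe : Measurable fun p : ℝ × EuclideanSpace ℝ (Fin n) => ‖f p.1 p.2‖ₑ := hf.enorm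
    have hG : Measurable fun p : ℝ × EuclideanSpace ℝ (Fin n) =>
        ENNReal.ofReal (gaussKernel t (0 - p.2)) :=
      ((continuous_gaussKernel t).measurable.comp
        (measurable_const.sub measurable_snd)).ennreal_ofReal
    have h := lintegral_slab_gaussKernel_le hα hf ht 0
    rw [hJ, mul_zero, nonpos_iff_eq_zero] at h
    replace h := (lintegral_eq_zero_iff (hfe.mul hG)).1 h
    have h0 : ∫⁻ p, ‖f p.1 p.2‖ₑ ∂(slab n t) = 0 := by
      rw [lintegral_eq_zero_iff hfe]
      filter_upwards [h] with p hp
      refine (mul_eq_zero.1 hp).resolve_right ?_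
      rw [ENNReal.ofReal_eq_zero, not_le]
      exact gaussKernel_pos ht.1 _
    rw [slab, lintegral_prod _ hfe.aemeasurable,
      lintegral_eq_zero_iff (hfe.lintegral_prod_right' (ν := volume))] at h0
    exact h0
  have hunion : Set.Ioo (0 : ℝ) 1 = ⋃ k : ℕ, Set.Ioo (0 : ℝ) (1 - 1 / ((k : ℝ) + 2)) := by
    ext t
    have h := Set.ext_iff.1 iUnion_Ioo_inv_eq (1 - t)
    simp only [Set.mem_iUnion, Set.mem_Ioo] at h ⊢
    constructor
    · intro ht
      obtain ⟨k, h1, -⟩ := h.2 ⟨by linarith, by linarith⟩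
      exact ⟨k, ht.1, by linarith⟩
    · rintro ⟨k, h1, h2⟩
      have : 0 < 1 / ((k : ℝ) + 2) := by positivity
      exact ⟨h1, by linarith⟩
  rw [hunion, ae_restrict_iUnion_iff]
  intro k
  refine hslice _ ⟨?_, ?_⟩
  · rw [sub_pos, div_lt_one (by positivity)]
    linarith [Nat.cast_nonneg (α := ℝ) k]
  · rw [sub_lt_self_iff]
    positivity

lemma integrable_slab_of_lintegral_lt_top {n : ℕ} {α : ℝ} (hα : 0 ≤ α)
    {f : ℝ → EuclideanSpace ℝ (Fin n) → ℂ} (hf : Measurable (Function.uncurry f))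
    (hI : ∫⁻ t in Set.Ioo (0 : ℝ) 1, (∫⁻ y, ‖f t y‖ₑ) * ENNReal.ofReal (t ^ (-α)) < ⊤) :
    Integrable (Function.uncurry f) (slab n 1) := by
  refine ⟨hf.aestronglyMeasurable, ?_⟩
  rw [hasFiniteIntegral_iff_enorm, slab, lintegral_prod _ hf.enorm.aemeasurable]
  refine lt_of_le_of_lt (setLIntegral_mono' measurableSet_Ioo fun t ht => ?_) hI
  have h1 : (1 : ℝ≥0∞) ≤ ENNReal.ofReal (t ^ (-α)) := by
    rw [ENNReal.one_le_ofReal]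
    exact Real.one_le_rpow_of_pos_of_le_one_of_nonpos ht.1 ht.2.le (by linarith)
  exact le_mul_of_one_le_right' h1

/-- `∫_0^1 ‖√(−Δ) e^{tΔ} ∫_0^t f(s,·) ds‖_{L²}² t^{−α} dt ≲ 𝖩(f;α) ∫_0^1 ‖f(t,·)‖_{L¹} t^{−α} dt`,
written on the Fourier side where `√(−Δ) e^{tΔ}` has symbol `2π|ζ| e^{−4π²t|ζ|²}`. -/
theorem sqrt_laplacian_heat_bound (n : ℕ) (hn : 1 ≤ n) (α : ℝ) (hα0 : 0 ≤ α) (hα1 : α < 1) :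
    ∃ C > (0 : ℝ), ∀ f : ℝ → EuclideanSpace ℝ (Fin n) → ℂ,
      Measurable (Function.uncurry f) →
      (∀ᵐ t ∂(volume.restrict (Set.Ioo (0 : ℝ) 1)), Integrable (f t) volume) →
      ∫⁻ t in Set.Ioo (0 : ℝ) 1,
          (∫⁻ ζ, ENNReal.ofReal ((2 * π * ‖ζ‖) ^ 2 * Real.exp (-8 * π ^ 2 * t * ‖ζ‖ ^ 2)) *
            (‖∫ s in Set.Ioo (0 : ℝ) t, spaceFourier n f s ζ‖₊ : ℝ≥0∞) ^ 2) *
          ENNReal.ofReal (t ^ (-α)) ≤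
        ENNReal.ofReal C * Jquant n α f *
          ∫⁻ t in Set.Ioo (0 : ℝ) 1,
            (∫⁻ y, (‖f t y‖₊ : ℝ≥0∞)) * ENNReal.ofReal (t ^ (-α)) := by
  refine ⟨(heatConst n).toReal, ENNReal.toReal_pos (heatConst_ne_zero n) (heatConst_ne_top n),
    fun f hf _ => ?_⟩
  rw [ENNReal.ofReal_toReal (heatConst_ne_top n)]
  simp only [← enorm_eq_nnnorm]
  by_cases hfin : ∫⁻ t in Set.Ioo (0 : ℝ) 1, (∫⁻ y, ‖f t y‖ₑ) * ENNReal.ofReal (t ^ (-α)) < ⊤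
  · have hI := integrable_slab_of_lintegral_lt_top hα0 hf hfin
    conv_lhs => rw [← iUnion_Ioo_inv_eq]
    rw [setLIntegral_iUnion_of_directed]
    · refine iSup_le fun k => lintegral_Ioo_heat_energy_le hα0 hf ⟨by positivity, ?_⟩ hI
      rw [div_lt_one (by positivity)]
      linarith [Nat.cast_nonneg (α := ℝ) k]
    · refine Monotone.directed_le fun j k hjk => Set.Ioo_subset_Ioo_left ?_
      gcongr
  · have htop := not_lt_top_iff.1 hfin
    have hJ : Jquant n α f ≠ 0 := by
      intro hJ
      refine hfin (lt_of_eq_of_lt ?_ ENNReal.zero_lt_top)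
      rw [lintegral_eq_zero_of_ae_eq_zero]
      filter_upwards [ae_lintegral_enorm_eq_zero_of_Jquant_eq_zero hα0 hf hJ] with s hs
      rw [hs, zero_mul, Pi.zero_apply]
    rw [htop, ENNReal.mul_top (mul_ne_zero (heatConst_ne_zero n) hJ)]
    exact le_top
end
end

section
/- Let n ≥ 2 and α ∈ [0,1). There is a constant C = C(n,α) > 0 such that for every f ∈ L²_{loc}(ℝⁿ) with ‖f‖_{L_{2,n−2}} < ∞, one has ‖f‖_{Q_α^{-1}} ≤ C ‖f‖_{L_{2,n−2}}; that is, the square Morrey space L_{2,n−2} embeds into Q_α^{-1}. -/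
open MeasureTheory Metric Real
open scoped ENNReal NNReal

noncomputable section

/-- The heat extension `e^{tΔ}f` of a function `f : ℝⁿ → ℂ`. -/
def heatExt (n : ℕ) (f : EuclideanSpace ℝ (Fin n) → ℂ) (t : ℝ)
    (x : EuclideanSpace ℝ (Fin n)) : ℂ :=
  ∫ y, ((4 * π * t) ^ (-(n : ℝ) / 2) * Real.exp (-‖x - y‖ ^ 2 / (4 * t))) • f y

/-- The `Q_α^{-1}` norm of `f`. -/
def QinvNorm (n : ℕ) (α : ℝ) (f : EuclideanSpace ℝ (Fin n) → ℂ) : ℝ≥0∞ :=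
  ⨆ (r : ℝ) (_ : 0 < r) (x : EuclideanSpace ℝ (Fin n)),
    (ENNReal.ofReal (r ^ (2 * α - (n : ℝ))) *
      ∫⁻ t in Set.Ioo (0 : ℝ) (r ^ 2),
        (∫⁻ y in Metric.ball x r, (‖heatExt n f t y‖₊ : ℝ≥0∞) ^ 2) *
          ENNReal.ofReal (t ^ (-α))) ^ (1 / 2 : ℝ)

/-- The square Morrey norm `‖f‖_{L_{2,n−2}}`. -/
def MorreyNorm (n : ℕ) (f : EuclideanSpace ℝ (Fin n) → ℂ) : ℝ≥0∞ :=
  ⨆ (r : ℝ) (_ : 0 < r) (x : EuclideanSpace ℝ (Fin n)),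
    (ENNReal.ofReal (r ^ ((2 : ℝ) - (n : ℝ))) *
      ∫⁻ y in Metric.ball x r, (‖f y‖₊ : ℝ≥0∞) ^ 2) ^ (1 / 2 : ℝ)

/-- The heat kernel on `ℝⁿ` has total mass one. -/
lemma lintegral_heatKernel (n : ℕ) {t : ℝ} (ht : 0 < t) :
    ∫⁻ z : EuclideanSpace ℝ (Fin n),
      ENNReal.ofReal ((4 * π * t) ^ (-(n : ℝ) / 2) * Real.exp (-‖z‖ ^ 2 / (4 * t))) = 1 := by
  have hb : 0 < 1 / (4 * t) := by positivity
  have hI := GaussianFourier.integral_rexp_neg_mul_sq_norm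
    (V := EuclideanSpace ℝ (Fin n)) hb
  have hfun : (fun z : EuclideanSpace ℝ (Fin n) => Real.exp (-‖z‖ ^ 2 / (4 * t))) =
      fun z => Real.exp (-(1 / (4 * t)) * ‖z‖ ^ 2) := by
    funext z
    congr 1
    ring
  have hπt : π / (1 / (4 * t)) = 4 * π * t := by
    field_simp
  rw [hπt, finrank_euclideanSpace_fin] at hI
  have hpos : 0 < 4 * π * t := by positivity
  have hint : Integrable
      (fun z : EuclideanSpace ℝ (Fin n) => Real.exp (-‖z‖ ^ 2 / (4 * t))) := by
    rw [hfun]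
    by_contra hcon
    rw [integral_undef hcon] at hI
    exact (Real.rpow_pos_of_pos hpos _).ne hI
  rw [← ofReal_integral_eq_lintegral_ofReal (hint.const_mul _)
    (Filter.Eventually.of_forall fun z => by positivity), integral_const_mul, hfun, hI,
    ← Real.rpow_add hpos]
  simp [neg_div]

/-- Jensen's inequality for the square, with respect to a density of total mass one. -/
lemma sq_lintegral_mul_le {X : Type*} [MeasurableSpace X] {μ : Measure X} {k g : X → ℝ≥0∞}
    (hk : Measurable k) (hg : Measurable g) (hk1 : ∫⁻ z, k z ∂μ = 1) :
    (∫⁻ z, k z * g z ∂μ) ^ 2 ≤ ∫⁻ z, k z * g z ^ 2 ∂μ := by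
  have h := ENNReal.lintegral_mul_le_Lp_mul_Lq (μ.withDensity k) Real.HolderConjugate.two_two
    hg.aemeasurable (aemeasurable_const (b := (1 : ℝ≥0∞)))
  have hw (u : X → ℝ≥0∞) (hu : Measurable u) :
      ∫⁻ z, u z ∂(μ.withDensity k) = ∫⁻ z, k z * u z ∂μ :=
    lintegral_withDensity_eq_lintegral_mul μ hk hu
  simp only [Pi.mul_apply, mul_one, ENNReal.rpow_two, one_pow] at h
  rw [hw g hg, hw _ (hg.pow_const 2), hw (fun _ => 1) measurable_const] at h
  simp only [mul_one, hk1, ENNReal.one_rpow] at h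
  calc (∫⁻ z, k z * g z ∂μ) ^ 2 ≤ ((∫⁻ z, k z * g z ^ 2 ∂μ) ^ (1 / 2 : ℝ)) ^ 2 := by gcongr
    _ = _ := by rw [← ENNReal.rpow_two, ← ENNReal.rpow_mul]; norm_num

/-- The square of the heat extension is dominated by the heat extension of the square. -/
lemma enorm_heatExt_sq_le (n : ℕ) {f : EuclideanSpace ℝ (Fin n) → ℂ} (hf : Measurable f) {t : ℝ}
    (ht : 0 < t) (y : EuclideanSpace ℝ (Fin n)) :
    ‖heatExt n f t y‖ₑ ^ 2 ≤
      ∫⁻ z, ENNReal.ofReal ((4 * π * t) ^ (-(n : ℝ) / 2) * Real.exp (-‖z‖ ^ 2 / (4 * t))) *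
        ‖f (y - z)‖ₑ ^ 2 := by
  have hle : ‖heatExt n f t y‖ₑ ≤
      ∫⁻ z, ENNReal.ofReal ((4 * π * t) ^ (-(n : ℝ) / 2) * Real.exp (-‖z‖ ^ 2 / (4 * t))) *
        ‖f (y - z)‖ₑ := by
    refine (enorm_integral_le_lintegral_enorm _).trans_eq ?_
    rw [← lintegral_sub_left_eq_self _ y]
    refine lintegral_congr fun z => ?_
    rw [enorm_smul, Real.enorm_of_nonneg (by positivity), sub_sub_cancel]
  refine le_trans (by gcongr) (sq_lintegral_mul_le (by fun_prop) (by fun_prop)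
    (lintegral_heatKernel n ht))

/-- The local `L²` bound contained in the Morrey norm. -/
lemma lintegral_ball_sq_le_morreyNorm (n : ℕ) (f : EuclideanSpace ℝ (Fin n) → ℂ) {r : ℝ}
    (hr : 0 < r) (x : EuclideanSpace ℝ (Fin n)) :
    ∫⁻ y in ball x r, ‖f y‖ₑ ^ 2 ≤
      ENNReal.ofReal (r ^ ((n : ℝ) - 2)) * MorreyNorm n f ^ 2 := by
  have h : (ENNReal.ofReal (r ^ ((2 : ℝ) - n)) * ∫⁻ y in ball x r, ‖f y‖ₑ ^ 2) ^ (1 / 2 : ℝ) ≤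
      MorreyNorm n f :=
    le_iSup_of_le r (le_iSup_of_le hr (le_iSup_of_le x le_rfl))
  rw [one_div, ENNReal.rpow_inv_le_iff two_pos, ENNReal.rpow_two] at h
  calc ∫⁻ y in ball x r, ‖f y‖ₑ ^ 2
      = ENNReal.ofReal (r ^ ((n : ℝ) - 2)) *
          (ENNReal.ofReal (r ^ ((2 : ℝ) - n)) * ∫⁻ y in ball x r, ‖f y‖ₑ ^ 2) := by
        rw [← mul_assoc, ← ENNReal.ofReal_mul (by positivity), ← Real.rpow_add hr]
        simp
    _ ≤ _ := by gcongr

/-- The heat extension does not increase the local `L²` bound given by the Morrey norm. -/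
lemma lintegral_ball_heatExt_sq_le (n : ℕ) {f : EuclideanSpace ℝ (Fin n) → ℂ} (hf : Measurable f)
    {t r : ℝ} (ht : 0 < t) (hr : 0 < r) (x : EuclideanSpace ℝ (Fin n)) :
    ∫⁻ y in ball x r, ‖heatExt n f t y‖ₑ ^ 2 ≤
      ENNReal.ofReal (r ^ ((n : ℝ) - 2)) * MorreyNorm n f ^ 2 := by
  set k : EuclideanSpace ℝ (Fin n) → ℝ≥0∞ := fun z =>
    ENNReal.ofReal ((4 * π * t) ^ (-(n : ℝ) / 2) * Real.exp (-‖z‖ ^ 2 / (4 * t))) with hk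
  have hkm : Measurable k := by fun_prop
  have hball (z : EuclideanSpace ℝ (Fin n)) :
      ∫⁻ y in ball x r, ‖f (y - z)‖ₑ ^ 2 = ∫⁻ y in ball (x - z) r, ‖f y‖ₑ ^ 2 := by
    rw [← lintegral_indicator measurableSet_ball, ← lintegral_indicator measurableSet_ball,
      ← lintegral_sub_right_eq_self ((ball (x - z) r).indicator _) z]
    refine lintegral_congr fun y => ?_
    have hmem : y - z ∈ ball (x - z) r ↔ y ∈ ball x r := by
      rw [mem_ball, mem_ball, dist_sub_right]
    by_cases hy : y ∈ ball x r
    · rw [Set.indicator_of_mem hy, Set.indicator_of_mem (hmem.2 hy)]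
    · rw [Set.indicator_of_notMem hy, Set.indicator_of_notMem (mt hmem.1 hy)]
  calc ∫⁻ y in ball x r, ‖heatExt n f t y‖ₑ ^ 2
      ≤ ∫⁻ y in ball x r, ∫⁻ z, k z * ‖f (y - z)‖ₑ ^ 2 :=
        lintegral_mono fun y => enorm_heatExt_sq_le n hf ht y
    _ = ∫⁻ z, ∫⁻ y in ball x r, k z * ‖f (y - z)‖ₑ ^ 2 :=
        lintegral_lintegral_swap (by fun_prop)
    _ = ∫⁻ z, k z * ∫⁻ y in ball (x - z) r, ‖f y‖ₑ ^ 2 := by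
        refine lintegral_congr fun z => ?_
        rw [lintegral_const_mul _ (by fun_prop), hball]
    _ ≤ ∫⁻ z, k z * (ENNReal.ofReal (r ^ ((n : ℝ) - 2)) * MorreyNorm n f ^ 2) := by
        gcongr with z
        exact lintegral_ball_sq_le_morreyNorm n f hr _
    _ = _ := by rw [lintegral_mul_const _ hkm, hk, lintegral_heatKernel n ht, one_mul]

lemma lintegral_Ioo_rpow_neg {α s : ℝ} (hα : α < 1) (hs : 0 < s) :
    ∫⁻ t in Set.Ioo (0 : ℝ) s, ENNReal.ofReal (t ^ (-α)) =
      ENNReal.ofReal (s ^ (1 - α) / (1 - α)) := by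
  have hint : IntervalIntegrable (fun t : ℝ => t ^ (-α)) volume 0 s :=
    intervalIntegral.intervalIntegrable_rpow' (by linarith)
  rw [setLIntegral_congr Ioo_ae_eq_Ioc, ← ofReal_integral_eq_lintegral_ofReal
    ((intervalIntegrable_iff_integrableOn_Ioc_of_le hs.le).1 hint)
    ((ae_restrict_mem measurableSet_Ioc).mono fun t ht => Real.rpow_nonneg ht.1.le _),
    ← intervalIntegral.integral_of_le hs.le, integral_rpow (Or.inl (by linarith)),
    Real.zero_rpow (by linarith), sub_zero, neg_add_eq_sub]

/-- The square Morrey space `L_{2,n−2}` embeds into `Q_α^{-1}` for `α ∈ [0,1)`, `n ≥ 2`. -/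
theorem morrey_subset_Qinv (n : ℕ) (hn : 2 ≤ n) (α : ℝ) (hα0 : 0 ≤ α) (hα1 : α < 1) :
    ∃ C > (0 : ℝ), ∀ f : EuclideanSpace ℝ (Fin n) → ℂ,
      Measurable f → LocallyIntegrable (fun y => ‖f y‖ ^ 2) volume →
      MorreyNorm n f ≠ ⊤ →
      QinvNorm n α f ≤ ENNReal.ofReal C * MorreyNorm n f := by
  have hα : 0 < 1 - α := by linarith
  refine ⟨(1 / (1 - α)) ^ (1 / 2 : ℝ), by positivity, fun f hf _ _ => ?_⟩
  refine iSup_le fun r => iSup_le fun hr => iSup_le fun x => ?_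
  have hbound : ∫⁻ t in Set.Ioo (0 : ℝ) (r ^ 2),
      (∫⁻ y in ball x r, ‖heatExt n f t y‖ₑ ^ 2) * ENNReal.ofReal (t ^ (-α)) ≤
      ENNReal.ofReal (r ^ ((n : ℝ) - 2)) * MorreyNorm n f ^ 2 *
        ENNReal.ofReal ((r ^ 2) ^ (1 - α) / (1 - α)) := by
    rw [← lintegral_Ioo_rpow_neg hα1 (by positivity), ← lintegral_const_mul _ (by fun_prop)]
    refine setLIntegral_mono' measurableSet_Ioo fun t ht => ?_
    gcongr
    exact lintegral_ball_heatExt_sq_le n hf ht.1 hr x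
  have hpow : r ^ (2 * α - (n : ℝ)) * (r ^ ((n : ℝ) - 2) * ((r ^ 2) ^ (1 - α) / (1 - α))) =
      1 / (1 - α) := by
    rw [← Real.rpow_natCast r 2, ← Real.rpow_mul hr.le, mul_div_assoc', mul_div_assoc',
      ← Real.rpow_add hr, ← Real.rpow_add hr]
    ring_nf
    simp
  calc _ ≤ (ENNReal.ofReal (r ^ (2 * α - (n : ℝ))) *
        (ENNReal.ofReal (r ^ ((n : ℝ) - 2)) * MorreyNorm n f ^ 2 *
          ENNReal.ofReal ((r ^ 2) ^ (1 - α) / (1 - α)))) ^ (1 / 2 : ℝ) := by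
        gcongr
        exact hbound
    _ = (ENNReal.ofReal (1 / (1 - α)) * MorreyNorm n f ^ 2) ^ (1 / 2 : ℝ) := by
        rw [mul_right_comm, ← mul_assoc, ← ENNReal.ofReal_mul (by positivity),
          ← ENNReal.ofReal_mul (by positivity), hpow]
    _ = _ := by
        rw [ENNReal.mul_rpow_of_nonneg _ _ (by norm_num),
          ENNReal.ofReal_rpow_of_pos (by positivity), ← ENNReal.rpow_two, ← ENNReal.rpow_mul]
        norm_num
end
end
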